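/- Let C be a real symmetric positive semidefinite n×n matrix, B a real skew-symmetric n×n matrix, and f₁, f₂ ∈ ℝ^n. Let w₁, w₂ be independent standard Gaussian random vectors in ℝ^n, ψ = w₁ + i w₂, and ψ(f) = Σ_k f_k ψ_k for f ∈ ℝ^n. Then E[ψ(f₁) \overline{ψ(f₂)} exp(−(1/2)⟨(C − B)ψ, ψ̄⟩)] = 2 · det(I + C + B)^{−1} · ⟨(I + C + B)^{−1} f₁, f₂⟩; equivalently, E[ψ(f₁)\overline{ψ(f₂)} e^{−(1/2)⟨(C−B)ψ,ψ̄⟩}] / E[e^{−(1/2)⟨(C−B)ψ,ψ̄⟩}] = 2⟨(I + C + B)^{−1} f₁, f₂⟩. -/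

import Mathlib

open MeasureTheory Matrix ProbabilityTheory ComplexConjugate

lemma aux_I2int {b : ℂ} (hb : 0 < b.re) :
    Integrable fun x : ℝ => (x : ℂ) ^ 2 * Complex.exp (-b * (x : ℂ) ^ 2) := by
  have h := integrable_rpow_mul_exp_neg_mul_sq hb (s := 2) (by norm_num)
  refine h.mono (by fun_prop) (Filter.Eventually.of_forall fun x => ?_)
  rw [norm_mul, norm_mul, norm_cexp_neg_mul_sq b]
  simp

lemma aux_I1 {b : ℂ} : ∫ x : ℝ, (x : ℂ) * Complex.exp (-b * (x : ℂ) ^ 2) = 0 := by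
  have h := integral_neg_eq_self (fun x : ℝ => (x : ℂ) * Complex.exp (-b * (x : ℂ) ^ 2)) volume
  simp only [Complex.ofReal_neg, neg_sq, neg_mul, integral_neg] at h
  simp only [neg_mul]
  exact self_eq_neg.mp h.symm

lemma aux_I2 {b : ℂ} (hb : 0 < b.re) :
    ∫ x : ℝ, (x : ℂ) ^ 2 * Complex.exp (-b * (x : ℂ) ^ 2)
      = (2 * b)⁻¹ * ∫ x : ℝ, Complex.exp (-b * (x : ℂ) ^ 2) := by
  have hb0 : b ≠ 0 := by rintro rfl; simp at hb
  have h := integral_eq_zero_of_hasDerivAt_of_integrable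
    (f := fun x : ℝ => (x : ℂ) * Complex.exp (-b * (x : ℂ) ^ 2))
    (f' := fun x : ℝ => Complex.exp (-b * (x : ℂ) ^ 2)
      - (2 * b) * ((x : ℂ) ^ 2 * Complex.exp (-b * (x : ℂ) ^ 2)))
    (fun x => by
      have h1 : HasDerivAt (fun z : ℂ => z * Complex.exp (-b * z ^ 2))
          (1 * Complex.exp (-b * (x : ℂ) ^ 2)
            + (x : ℂ) * (Complex.exp (-b * (x : ℂ) ^ 2) * (-b * (((2 : ℕ) : ℂ) * (x : ℂ) ^ (2 - 1) * 1)))) (x : ℂ) :=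
        (hasDerivAt_id' _).mul ((((hasDerivAt_id' _).pow 2).const_mul (-b)).cexp)
      have h2 := h1.comp_ofReal
      refine h2.congr_deriv ?_
      push_cast
      ring)
    ((integrable_cexp_neg_mul_sq hb).sub ((aux_I2int hb).const_mul _))
    (integrable_mul_cexp_neg_mul_sq hb)
  rw [integral_sub (integrable_cexp_neg_mul_sq hb) ((aux_I2int hb).const_mul _),
    integral_const_mul, sub_eq_zero] at h
  rw [h, ← mul_assoc, inv_mul_cancel₀ (by simpa using hb0), one_mul]

/-- one-dimensional complex Gaussian -/
noncomputable def gz (b : ℂ) (z : ℂ) : ℂ := Complex.exp (-(1/2) * (b * (z * conj z)))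

lemma gz_mk (b : ℂ) (p : ℝ × ℝ) : gz b (Complex.measurableEquivRealProd.symm p)
    = Complex.exp (-(b/2) * (p.1 : ℂ) ^ 2) * Complex.exp (-(b/2) * (p.2 : ℂ) ^ 2) := by
  rw [gz, ← Complex.exp_add]
  congr 1
  rw [Complex.mul_conj]
  simp [Complex.normSq_apply]
  ring

lemma mk_eq (p : ℝ × ℝ) : (Complex.measurableEquivRealProd.symm p : ℂ) = p.1 + p.2 * Complex.I := by
  apply Complex.ext <;> simp

lemma gz_transfer (F : ℂ → ℂ) :
    ∫ z, F z = ∫ p : ℝ × ℝ, F (Complex.measurableEquivRealProd.symm p) :=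
  ((Complex.volume_preserving_equiv_real_prod.symm).integral_comp
    (Complex.measurableEquivRealProd.symm.measurableEmbedding) F).symm

lemma gz_transfer_int (F : ℂ → ℂ)
    (h : Integrable (fun p : ℝ × ℝ => F (Complex.measurableEquivRealProd.symm p))) :
    Integrable F :=
  ((Complex.volume_preserving_equiv_real_prod.symm).integrable_comp_emb
    (Complex.measurableEquivRealProd.symm.measurableEmbedding)).mp h

lemma half_re {b : ℂ} (hb : 0 < b.re) : 0 < (b/2).re := by
  simp; exact hb

lemma gz_int {b : ℂ} (hb : 0 < b.re) : Integrable (gz b) := by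
  apply gz_transfer_int
  simp only [gz_mk]
  exact (integrable_cexp_neg_mul_sq (half_re hb)).mul_prod (integrable_cexp_neg_mul_sq (half_re hb))

lemma gz_I0 {b : ℂ} (hb : 0 < b.re) : ∫ z, gz b z = 2 * Real.pi / b := by
  have hb0 : b ≠ 0 := by rintro rfl; simp at hb
  rw [gz_transfer]
  simp only [gz_mk]
  rw [Measure.volume_eq_prod, integral_prod_mul
    (fun x : ℝ => Complex.exp (-(b/2) * (x : ℂ) ^ 2)) (fun x : ℝ => Complex.exp (-(b/2) * (x : ℂ) ^ 2)),
    ← sq, integral_gaussian_sq_complex (half_re hb)]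
  field_simp

lemma gz_int1 {b : ℂ} (hb : 0 < b.re) : Integrable (fun z => z * gz b z) := by
  apply gz_transfer_int
  simp only [gz_mk]
  simp only [mk_eq]
  have h1 := (integrable_mul_cexp_neg_mul_sq (half_re hb)).mul_prod (integrable_cexp_neg_mul_sq (half_re hb))
  have h2 := (integrable_cexp_neg_mul_sq (half_re hb)).mul_prod (integrable_mul_cexp_neg_mul_sq (half_re hb))
  refine (h1.add (h2.const_mul Complex.I)).congr (Filter.Eventually.of_forall fun p => ?_)
  simp only [Pi.add_apply]; ring

lemma gz_int1' {b : ℂ} (hb : 0 < b.re) : Integrable (fun z => conj z * gz b z) := by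
  refine (gz_int1 hb).mono ?_ (Filter.Eventually.of_forall fun z => by simp)
  exact (Complex.continuous_conj.aestronglyMeasurable).mul (gz_int hb).aestronglyMeasurable

lemma gz_int2 {b : ℂ} (hb : 0 < b.re) : Integrable (fun z => z * conj z * gz b z) := by
  apply gz_transfer_int
  simp only [gz_mk]
  simp only [mk_eq]
  have h1 := (aux_I2int (half_re hb)).mul_prod (integrable_cexp_neg_mul_sq (half_re hb))
  have h2 := (integrable_cexp_neg_mul_sq (half_re hb)).mul_prod (aux_I2int (half_re hb))
  refine (h1.add h2).congr (Filter.Eventually.of_forall fun p => ?_)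
  simp only [Pi.add_apply, map_add, map_mul, Complex.conj_ofReal, Complex.conj_I]
  linear_combination (p.2 : ℂ) ^ 2 * (Complex.exp (-(b/2) * (p.1 : ℂ) ^ 2) * Complex.exp (-(b/2) * (p.2 : ℂ) ^ 2)) * Complex.I_sq

lemma gz_neg (b z : ℂ) : gz b (-z) = gz b z := by simp [gz]

lemma gz_I1 {b : ℂ} : ∫ z, z * gz b z = 0 := by
  have h := integral_neg_eq_self (fun z : ℂ => z * gz b z) volume
  simp only [gz_neg, neg_mul, integral_neg] at h
  exact self_eq_neg.mp h.symm

lemma gz_I1' {b : ℂ} : ∫ z, conj z * gz b z = 0 := by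
  have h := integral_neg_eq_self (fun z : ℂ => conj z * gz b z) volume
  simp only [gz_neg, neg_mul, integral_neg, map_neg] at h
  exact self_eq_neg.mp h.symm

lemma gz_I2 {b : ℂ} (hb : 0 < b.re) : ∫ z, z * conj z * gz b z = 2 * Real.pi / b * (2 / b) := by
  have hb0 : b ≠ 0 := by rintro rfl; simp at hb
  rw [gz_transfer]
  simp only [gz_mk]
  simp only [mk_eq]
  have h1 := (aux_I2int (half_re hb)).mul_prod (integrable_cexp_neg_mul_sq (half_re hb))
  have h2 := (integrable_cexp_neg_mul_sq (half_re hb)).mul_prod (aux_I2int (half_re hb))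
  have e : ∀ p : ℝ × ℝ, ((p.1 : ℂ) + p.2 * Complex.I) * conj ((p.1 : ℂ) + p.2 * Complex.I) *
      (Complex.exp (-(b/2) * (p.1 : ℂ) ^ 2) * Complex.exp (-(b/2) * (p.2 : ℂ) ^ 2))
      = ((p.1 : ℂ) ^ 2 * Complex.exp (-(b/2) * (p.1 : ℂ) ^ 2)) * Complex.exp (-(b/2) * (p.2 : ℂ) ^ 2)
       + Complex.exp (-(b/2) * (p.1 : ℂ) ^ 2) * ((p.2 : ℂ) ^ 2 * Complex.exp (-(b/2) * (p.2 : ℂ) ^ 2)) := by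
    intro p
    simp only [map_add, map_mul, Complex.conj_ofReal, Complex.conj_I]
    linear_combination -(p.2 : ℂ) ^ 2 * (Complex.exp (-(b/2) * (p.1 : ℂ) ^ 2) * Complex.exp (-(b/2) * (p.2 : ℂ) ^ 2)) * Complex.I_sq
  simp only [e]
  rw [Measure.volume_eq_prod, integral_add h1 h2, integral_prod_mul
    (fun x : ℝ => (x : ℂ) ^ 2 * Complex.exp (-(b/2) * (x : ℂ) ^ 2)) (fun x : ℝ => Complex.exp (-(b/2) * (x : ℂ) ^ 2)),
    integral_prod_mul (fun x : ℝ => Complex.exp (-(b/2) * (x : ℂ) ^ 2))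
    (fun x : ℝ => (x : ℂ) ^ 2 * Complex.exp (-(b/2) * (x : ℂ) ^ 2)), aux_I2 (half_re hb)]
  have h3 := integral_gaussian_sq_complex (half_re hb)
  have h4 : (2 * Real.pi / b : ℂ) = Real.pi / (b/2) := by field_simp
  rw [h4, ← h3]
  field_simp
  ring

section
variable {n : ℕ}

lemma diag_prod (b : Fin n → ℂ) (φ : Fin n → ℂ) :
    Complex.exp (-(1/2) * ∑ l, b l * (φ l * conj (φ l))) = ∏ l, gz (b l) (φ l) := by
  rw [Finset.mul_sum, Complex.exp_sum]; rfl

lemma diag_I0 (b : Fin n → ℂ) (hb : ∀ l, 0 < (b l).re) :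
    ∫ φ : Fin n → ℂ, Complex.exp (-(1/2) * ∑ l, b l * (φ l * conj (φ l)))
      = ∏ l, (2 * Real.pi / b l) := by
  simp only [diag_prod]
  rw [integral_fintype_prod_volume_eq_prod (fun l => gz (b l))]
  exact Finset.prod_congr rfl fun l _ => gz_I0 (hb l)

noncomputable def gf (b : Fin n → ℂ) (j k l : Fin n) (z : ℂ) : ℂ :=
  (if l = j then z else 1) * (if l = k then conj z else 1) * gz (b l) z

lemma gf_prod (b : Fin n → ℂ) (j k : Fin n) (φ : Fin n → ℂ) :
    φ j * conj (φ k) * Complex.exp (-(1/2) * ∑ l, b l * (φ l * conj (φ l)))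
      = ∏ l, gf b j k l (φ l) := by
  simp only [gf, Finset.prod_mul_distrib, diag_prod]
  simp

lemma gf_int (b : Fin n → ℂ) (hb : ∀ l, 0 < (b l).re) (j k l : Fin n) :
    Integrable (gf b j k l) := by
  unfold gf
  by_cases h1 : l = j <;> by_cases h2 : l = k <;> simp only [h1, h2, if_true, if_false, one_mul, mul_one]
  · subst h1; subst h2; simpa using gz_int2 (hb l)
  · subst h1; simpa [h2] using gz_int1 (hb l)
  · subst h2; simpa [h1] using gz_int1' (hb l)
  · exact gz_int (hb l)

lemma gf_prod_int (b : Fin n → ℂ) (hb : ∀ l, 0 < (b l).re) (j k : Fin n) :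
    Integrable (fun φ : Fin n → ℂ =>
      φ j * conj (φ k) * Complex.exp (-(1/2) * ∑ l, b l * (φ l * conj (φ l)))) := by
  simp only [gf_prod]
  exact Integrable.fintype_prod (fun l => gf_int b hb j k l)

lemma gf_I (b : Fin n → ℂ) (hb : ∀ l, 0 < (b l).re) (j k : Fin n) :
    ∫ φ : Fin n → ℂ, φ j * conj (φ k) * Complex.exp (-(1/2) * ∑ l, b l * (φ l * conj (φ l)))
      = if j = k then (∏ l, (2 * Real.pi / b l)) * (2 / b j) else 0 := by
  simp only [gf_prod]
  rw [integral_fintype_prod_volume_eq_prod (fun l => gf b j k l)]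
  split_ifs with h
  · subst h
    have : ∀ l, ∫ z, gf b j j l z = 2 * Real.pi / b l * (if l = j then 2 / b j else 1) := by
      intro l
      unfold gf
      split_ifs with h
      · subst h; exact gz_I2 (hb l)
      · simp only [one_mul, mul_one]; exact gz_I0 (hb l)
    simp only [this, Finset.prod_mul_distrib]
    simp
  · apply Finset.prod_eq_zero (Finset.mem_univ j)
    simp only [gf, if_true, if_neg h, mul_one]
    exact gz_I1

lemma diag_I2 (b : Fin n → ℂ) (hb : ∀ l, 0 < (b l).re) (a c : Fin n → ℂ) :
    ∫ φ : Fin n → ℂ, (∑ j, a j * φ j) * (∑ k, c k * conj (φ k)) *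
        Complex.exp (-(1/2) * ∑ l, b l * (φ l * conj (φ l)))
      = (∏ l, (2 * Real.pi / b l)) * ∑ j, a j * c j * (2 / b j) := by
  have e : ∀ φ : Fin n → ℂ, (∑ j, a j * φ j) * (∑ k, c k * conj (φ k)) *
        Complex.exp (-(1/2) * ∑ l, b l * (φ l * conj (φ l)))
      = ∑ j, ∑ k, a j * c k * (φ j * conj (φ k) *
        Complex.exp (-(1/2) * ∑ l, b l * (φ l * conj (φ l)))) := by
    intro φ
    rw [Finset.sum_mul_sum, Finset.sum_mul]
    refine Finset.sum_congr rfl fun j _ => ?_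
    rw [Finset.sum_mul]
    refine Finset.sum_congr rfl fun k _ => ?_
    ring
  simp only [e]
  rw [integral_finsetSum _ (fun j _ => integrable_finsetSum _ fun k _ =>
    (gf_prod_int b hb j k).const_mul _)]
  rw [Finset.mul_sum]
  refine Finset.sum_congr rfl fun j _ => ?_
  rw [integral_finsetSum _ (fun k _ => (gf_prod_int b hb j k).const_mul _)]
  simp only [integral_const_mul, gf_I b hb]
  simp
  ring
end
section
variable {n : ℕ}

lemma pi_gauss : (Measure.pi fun _ : Fin n => gaussianReal 0 1)
    = (volume : Measure (Fin n → ℝ)).withDensity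
      (fun x => ENNReal.ofReal (∏ i, gaussianPDFReal 0 1 (x i))) := by
  refine Measure.pi_eq fun s hs => ?_
  rw [withDensity_apply _ (MeasurableSet.univ_pi hs), volume_pi, Measure.restrict_pi_pi]
  rw [← ofReal_integral_eq_lintegral_ofReal]
  · rw [integral_fintype_prod_eq_prod (fun _ => gaussianPDFReal 0 1),
      ENNReal.ofReal_prod_of_nonneg]
    · refine Finset.prod_congr rfl fun i _ => ?_
      rw [gaussianReal_apply_eq_integral _ one_ne_zero]
    · intro i _
      exact integral_nonneg fun x => gaussianPDFReal_nonneg _ _ _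
  · exact Integrable.fintype_prod (fun i => (integrable_gaussianPDFReal 0 1).restrict)
  · exact Filter.Eventually.of_forall fun x => Finset.prod_nonneg fun i _ => gaussianPDFReal_nonneg _ _ _

lemma transfer (F : (Fin n → ℝ) × (Fin n → ℝ) → ℂ) :
    ∫ w, F w ∂((Measure.pi fun _ : Fin n => gaussianReal 0 1).prod
            (Measure.pi fun _ : Fin n => gaussianReal 0 1))
    = ((2 * Real.pi : ℂ)⁻¹) ^ n * ∫ ψ : Fin n → ℂ, F (fun i => (ψ i).re, fun i => (ψ i).im) *
        Complex.exp (-(1/2) * ∑ l, (ψ l * conj (ψ l))) := by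
  have hm : Measurable (fun x : Fin n → ℝ => ENNReal.ofReal (∏ i, gaussianPDFReal 0 1 (x i))) := by
    refine ENNReal.measurable_ofReal.comp ?_
    exact Finset.measurable_prod _ fun i _ => (measurable_gaussianPDFReal 0 1).comp (measurable_pi_apply i)
  have hn : ∀ x : Fin n → ℝ, 0 ≤ ∏ i, gaussianPDFReal 0 1 (x i) :=
    fun x => Finset.prod_nonneg fun i _ => gaussianPDFReal_nonneg _ _ _
  have hmp : MeasurePreserving (fun ψ : Fin n → ℂ => ((fun i => (ψ i).re, fun i => (ψ i).im) :
      (Fin n → ℝ) × (Fin n → ℝ))) volume volume :=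
    (volume_measurePreserving_arrowProdEquivProdArrow ℝ ℝ (Fin n)).comp
      (volume_preserving_pi fun _ : Fin n => Complex.volume_preserving_equiv_real_prod)
  have hemb : MeasurableEmbedding (fun ψ : Fin n → ℂ => ((fun i => (ψ i).re, fun i => (ψ i).im) :
      (Fin n → ℝ) × (Fin n → ℝ))) :=
    ((MeasurableEquiv.piCongrRight fun _ : Fin n => Complex.measurableEquivRealProd).trans
      (MeasurableEquiv.arrowProdEquivProdArrow ℝ ℝ (Fin n))).measurableEmbedding
  rw [pi_gauss, prod_withDensity hm hm, ← Measure.volume_eq_prod,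
    integral_withDensity_eq_integral_toReal_smul (by fun_prop)
      (Filter.Eventually.of_forall fun x => ENNReal.mul_lt_top ENNReal.ofReal_lt_top ENNReal.ofReal_lt_top),
    ← hmp.integral_comp hemb, ← integral_const_mul]
  congr 1
  ext ψ
  rw [ENNReal.toReal_mul, ENNReal.toReal_ofReal (hn _), ENNReal.toReal_ofReal (hn _),
    ← Finset.prod_mul_distrib, Complex.real_smul, Finset.mul_sum, Complex.exp_sum, Complex.ofReal_prod]
  have : ∀ i, ((gaussianPDFReal 0 1 (ψ i).re * gaussianPDFReal 0 1 (ψ i).im : ℝ) : ℂ)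
      = (2 * Real.pi : ℂ)⁻¹ * Complex.exp (-(1/2) * (ψ i * conj (ψ i))) := by
    intro i
    have h2 : gaussianPDFReal 0 1 (ψ i).re * gaussianPDFReal 0 1 (ψ i).im
      = (2 * Real.pi)⁻¹ * Real.exp (-(1/2) * Complex.normSq (ψ i)) := by
      have hs : (√(2 * Real.pi))⁻¹ * (√(2 * Real.pi))⁻¹ = (2 * Real.pi)⁻¹ := by
        rw [← mul_inv, Real.mul_self_sqrt (by positivity)]
      simp only [gaussianPDFReal, NNReal.coe_one, mul_one, sub_zero]
      rw [mul_mul_mul_comm, hs, ← Real.exp_add, Complex.normSq_apply]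
      congr 2
      ring
    rw [h2, Complex.mul_conj]
    push_cast
    rfl
  simp only [this, Finset.prod_mul_distrib]
  simp
  ring

lemma cov (Q : Matrix (Fin n) (Fin n) ℂ) (hQ : Q.det ≠ 0) (F : (Fin n → ℂ) → ℂ) :
    ∫ ψ, F ψ = (Q.det * conj Q.det) * ∫ φ, F (Q *ᵥ φ) := by
  let f : (Fin n → ℂ) →ₗ[ℝ] (Fin n → ℂ) := (Matrix.toLin' Q).restrictScalars ℝ
  have hdet : LinearMap.det f = Complex.normSq Q.det := by
    rw [LinearMap.det_restrictScalars, Algebra.norm_complex_apply, LinearMap.det_toLin']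
  have hns : 0 < Complex.normSq Q.det := Complex.normSq_pos.mpr hQ
  have hf : LinearMap.det f ≠ 0 := by rw [hdet]; exact hns.ne'
  have h := Measure.map_linearMap_addHaar_eq_smul_addHaar (volume : Measure (Fin n → ℂ)) hf
  have hemb : MeasurableEmbedding f :=
    ((LinearEquiv.ofIsUnitDet (f := f) (v := Module.finBasis ℝ _) (v' := Module.finBasis ℝ _) (by
      rw [LinearMap.det_toMatrix]; exact hf.isUnit)).toContinuousLinearEquiv.toHomeomorph.measurableEmbedding)
  have h2 : ∫ φ, F (Q *ᵥ φ) = ∫ ψ, F ψ ∂(Measure.map f volume) := by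
    rw [hemb.integral_map]; rfl
  rw [h2, h, integral_smul_measure, hdet, Complex.mul_conj, abs_of_pos (inv_pos.mpr hns),
    ENNReal.toReal_ofReal (inv_pos.mpr hns).le, Complex.real_smul]
  have : (Complex.normSq Q.det : ℂ) ≠ 0 := by exact_mod_cast hns.ne'
  push_cast
  field_simp

lemma diagonalize (C B : Matrix (Fin n) (Fin n) ℝ) (hC : C.PosSemidef) (hB : Bᵀ = -B) :
    ∃ (Q : Matrix (Fin n) (Fin n) ℂ) (b : Fin n → ℂ), Q.det ≠ 0 ∧ (∀ l, 0 < (b l).re) ∧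
      Qᴴ * ((1 + C - B).map Complex.ofReal) * Q = Matrix.diagonal b := by
  have hH : (1 + C).PosDef := Matrix.PosDef.one.add_posSemidef hC
  open scoped MatrixOrder in
  obtain ⟨R, hR⟩ := CStarAlgebra.nonneg_iff_eq_star_mul_self.mp hH.posSemidef.nonneg
  have hRdet : R.det ≠ 0 := by
    intro h0
    have := hH.det_pos
    rw [hR, Matrix.det_mul, h0, mul_zero] at this
    exact lt_irrefl _ this
  set S : Matrix (Fin n) (Fin n) ℂ := R.map Complex.ofReal with hS
  have hSdet : IsUnit S.det := by
    have : S.det = (R.det : ℂ) := (Complex.ofRealHom.map_det R).symm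
    rw [this]; exact (Complex.ofReal_ne_zero.mpr hRdet).isUnit
  have hHS : (1 + C).map Complex.ofReal = Sᴴ * S := by
    rw [hR]
    ext i j
    simp [Matrix.mul_apply, hS, Matrix.star_apply]
  set T : Matrix (Fin n) (Fin n) ℂ := Complex.I • B.map Complex.ofReal with hT
  have hTh : Tᴴ = T := by
    ext i j
    have := congrFun (congrFun hB i) j
    simp only [Matrix.transpose_apply, Matrix.neg_apply] at this
    simp [hT, this]
  have hA : (S⁻¹ᴴ * T * S⁻¹).IsHermitian := by
    unfold Matrix.IsHermitian
    rw [Matrix.conjTranspose_mul, Matrix.conjTranspose_mul, hTh, Matrix.conjTranspose_conjTranspose,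
      Matrix.mul_assoc]
  have hd := hA.conjStarAlgAut_star_eigenvectorUnitary
  rw [Unitary.conjStarAlgAut_star_apply] at hd
  set U : Matrix (Fin n) (Fin n) ℂ := (hA.eigenvectorUnitary : Matrix (Fin n) (Fin n) ℂ) with hU
  have hUU : Uᴴ * U = 1 := Unitary.coe_star_mul_self hA.eigenvectorUnitary
  have hUdet : U.det ≠ 0 := by
    intro h0
    have := congrArg Matrix.det hUU
    rw [Matrix.det_mul, h0] at this
    simp at this
  have hM : (1 + C - B).map Complex.ofReal = Sᴴ * S + Complex.I • T := by
    rw [← hHS]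
    ext i j
    simp only [hT, Matrix.map_apply, Matrix.sub_apply, Matrix.add_apply, Matrix.smul_apply, smul_eq_mul,
      ← mul_assoc, Complex.I_mul_I]
    push_cast
    ring
  refine ⟨S⁻¹ * U, fun l => 1 + Complex.I * (hA.eigenvalues l : ℂ), ?_, ?_, ?_⟩
  · rw [Matrix.det_mul]
    exact mul_ne_zero ((Matrix.isUnit_nonsing_inv_det _ hSdet).ne_zero) hUdet
  · intro l; simp
  · have e1 : S * S⁻¹ = 1 := Matrix.mul_nonsing_inv _ hSdet
    have e2 : S⁻¹ᴴ * Sᴴ = 1 := by rw [← Matrix.conjTranspose_mul, e1, Matrix.conjTranspose_one]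
    rw [hM, Matrix.conjTranspose_mul]
    have : Uᴴ * S⁻¹ᴴ * (Sᴴ * S + Complex.I • T) * (S⁻¹ * U)
        = Uᴴ * ((S⁻¹ᴴ * Sᴴ) * (S * S⁻¹)) * U + Complex.I • (Uᴴ * (S⁻¹ᴴ * T * S⁻¹) * U) := by
      simp only [Matrix.mul_add, Matrix.add_mul, Matrix.mul_smul, Matrix.smul_mul, Matrix.mul_assoc]
    rw [this, e1, e2]
    simp only [Matrix.mul_one, hUU]
    rw [← Matrix.star_eq_conjTranspose U]
    rw [hd]
    ext i j
    by_cases h : i = j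
    · subst h; simp
    · simp [h]
end
section
variable {n : ℕ}

lemma quad_eq (K Q : Matrix (Fin n) (Fin n) ℂ) (b : Fin n → ℂ)
    (h : Qᴴ * K * Q = Matrix.diagonal b) (φ : Fin n → ℂ) :
    ∑ k, (K *ᵥ (Q *ᵥ φ)) k * conj ((Q *ᵥ φ) k) = ∑ l, b l * (φ l * conj (φ l)) := by
  have h1 : ∑ k, (K *ᵥ (Q *ᵥ φ)) k * conj ((Q *ᵥ φ) k)
      = (K *ᵥ (Q *ᵥ φ)) ⬝ᵥ star (Q *ᵥ φ) := rfl
  rw [h1, Matrix.star_mulVec, dotProduct_comm, ← Matrix.dotProduct_mulVec, Matrix.mulVec_mulVec,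
    Matrix.mulVec_mulVec, h]
  simp only [dotProduct, Matrix.mulVec_diagonal, Pi.star_apply]
  refine Finset.sum_congr rfl fun l _ => ?_
  simp only [RCLike.star_def]
  ring

lemma lin_eq (Q : Matrix (Fin n) (Fin n) ℂ) (f φ : Fin n → ℂ) :
    ∑ k, f k * (Q *ᵥ φ) k = ∑ j, (f ᵥ* Q) j * φ j :=
  Matrix.dotProduct_mulVec f Q φ

lemma integrand_eq (C B : Matrix (Fin n) (Fin n) ℝ) (ψ : Fin n → ℂ) :
    Complex.exp (-(1/2) * ∑ k, ((C - B).map Complex.ofReal *ᵥ ψ) k * conj (ψ k)) *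
      Complex.exp (-(1/2) * ∑ l, (ψ l * conj (ψ l)))
    = Complex.exp (-(1/2) * ∑ k, ((1 + C - B).map Complex.ofReal *ᵥ ψ) k * conj (ψ k)) := by
  have : (1 + C - B).map Complex.ofReal = 1 + (C - B).map Complex.ofReal := by
    ext i j
    by_cases h : i = j <;> simp [h] ; ring
  rw [this, ← Complex.exp_add, ← mul_add, ← Finset.sum_add_distrib, Matrix.add_mulVec, Matrix.one_mulVec]
  congr 2
  refine Finset.sum_congr rfl fun l _ => ?_
  simp only [Pi.add_apply]
  ring

lemma conj_lin (f : Fin n → ℝ) (ψ : Fin n → ℂ) :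
    conj (∑ k, (f k : ℂ) * ψ k) = ∑ k, conj ((f k : ℂ) * ψ k) := map_sum _ _ _

lemma re_add (z : ℂ) : (z.re : ℂ) + Complex.I * (z.im : ℂ) = z := by
  rw [mul_comm]; exact Complex.re_add_im z

lemma main_Z (C B : Matrix (Fin n) (Fin n) ℝ) (Q : Matrix (Fin n) (Fin n) ℂ) (b : Fin n → ℂ)
    (hb : ∀ l, 0 < (b l).re)
    (h : Qᴴ * ((1 + C - B).map Complex.ofReal) * Q = Matrix.diagonal b) :
    (1 + C + B)ᵀ = 1 + C - B → 
    (((1 + C + B).det : ℝ) : ℂ) ≠ 0 ∧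
    ((2 * Real.pi : ℂ)⁻¹) ^ n * ((Q.det * conj Q.det) * ∏ l, (2 * Real.pi / b l))
      = (((1 + C + B).det : ℝ) : ℂ)⁻¹ := by
  intro hT
  have hd := congrArg Matrix.det h
  have hK : ((1 + C - B).map Complex.ofReal).det = (((1 + C + B).det : ℝ) : ℂ) := by
    rw [← Matrix.det_transpose (1 + C + B), hT]
    exact (Complex.ofRealHom.map_det _).symm
  rw [Matrix.det_mul, Matrix.det_mul, hK, Matrix.det_conjTranspose, Matrix.det_diagonal] at hd
  have hb0 : ∏ l, b l ≠ 0 := Finset.prod_ne_zero_iff.mpr fun l _ h0 => by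
    have := hb l; rw [h0] at this; simp at this
  have hpi : (2 * Real.pi : ℂ) ≠ 0 := by simp [Real.pi_ne_zero]
  have hne : (((1 + C + B).det : ℝ) : ℂ) ≠ 0 := by
    intro h0; rw [h0] at hd; simp at hd; exact hb0 hd.symm
  refine ⟨hne, ?_⟩
  rw [Finset.prod_div_distrib, Finset.prod_const, Finset.card_univ, Fintype.card_fin, inv_pow]
  have hp := pow_ne_zero n hpi
  apply eq_inv_of_mul_eq_one_left
  have hd' : conj Q.det * (((1 + C + B).det : ℝ) : ℂ) * Q.det = ∏ l, b l := hd
  have : Q.det * conj Q.det * (((1 + C + B).det : ℝ) : ℂ) = ∏ l, b l := by rw [← hd']; ring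
  calc _ = (((2 * Real.pi : ℂ) ^ n)⁻¹ * (2 * Real.pi : ℂ) ^ n) *
      ((Q.det * conj Q.det * (((1 + C + B).det : ℝ) : ℂ)) / ∏ l, b l) := by ring
    _ = 1 := by rw [this, inv_mul_cancel₀ hp, div_self hb0, one_mul]

lemma main_lin (C B : Matrix (Fin n) (Fin n) ℝ) (Q : Matrix (Fin n) (Fin n) ℂ) (b : Fin n → ℂ)
    (hb : ∀ l, 0 < (b l).re)
    (h : Qᴴ * ((1 + C - B).map Complex.ofReal) * Q = Matrix.diagonal b)
    (hT : (1 + C + B)ᵀ = 1 + C - B) (hdet : (1 + C + B).det ≠ 0) (f₁ f₂ : Fin n → ℝ) :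
    ∑ j, ((fun k => (f₁ k : ℂ)) ᵥ* Q) j * conj (((fun k => (f₂ k : ℂ)) ᵥ* Q) j) * (2 / b j)
      = 2 * ((((1 + C + B)⁻¹ *ᵥ f₁) ⬝ᵥ f₂ : ℝ) : ℂ) := by
  have hb0 : ∀ l, b l ≠ 0 := fun l h0 => by have := hb l; rw [h0] at this; simp at this
  set K := (1 + C - B).map Complex.ofReal with hKdef
  set X := (1 + C + B)⁻¹ with hX
  have hDD : Matrix.diagonal b * Matrix.diagonal (fun l => (b l)⁻¹) = 1 := by
    rw [Matrix.diagonal_mul_diagonal, ← Matrix.diagonal_one]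
    congr 1; ext l; exact mul_inv_cancel₀ (hb0 l)
  have h1 : (Q * Matrix.diagonal (fun l => (b l)⁻¹) * Qᴴ) * K = 1 := by
    rw [← h] at hDD
    have h2 : (Qᴴ * K) * (Q * Matrix.diagonal (fun l => (b l)⁻¹)) = 1 := by
      rw [← hDD]; simp only [Matrix.mul_assoc]
    have h3 := mul_eq_one_comm.mp h2
    rw [← h3]; simp only [Matrix.mul_assoc]
  have h2 : K * Xᵀ.map Complex.ofReal = 1 := by
    have : (1 + C - B) * Xᵀ = 1 := by
      rw [← hT, ← Matrix.transpose_mul, hX, Matrix.nonsing_inv_mul _ hdet.isUnit, Matrix.transpose_one]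
    have h4 := congrArg (fun M : Matrix (Fin n) (Fin n) ℝ => M.map Complex.ofRealHom) this
    simp only [Matrix.map_mul] at h4
    rw [Matrix.map_one _ (map_zero _) (map_one _)] at h4
    exact h4
  have h3 : Q * Matrix.diagonal (fun l => (b l)⁻¹) * Qᴴ = Xᵀ.map Complex.ofReal :=
    left_inv_eq_right_inv h1 h2
  have hr : ((X *ᵥ f₁) ⬝ᵥ f₂ : ℝ) = f₁ ⬝ᵥ (Xᵀ *ᵥ f₂) := by
    rw [Matrix.dotProduct_mulVec, Matrix.vecMul_transpose]
  have hc : ((f₁ ⬝ᵥ (Xᵀ *ᵥ f₂) : ℝ) : ℂ)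
      = (fun k => (f₁ k : ℂ)) ⬝ᵥ ((Xᵀ.map Complex.ofReal) *ᵥ (fun k => (f₂ k : ℂ))) := by
    simp [dotProduct, Matrix.mulVec]
  rw [hr, hc, ← h3, ← Matrix.mulVec_mulVec, ← Matrix.mulVec_mulVec, Matrix.dotProduct_mulVec,
    dotProduct, Finset.mul_sum]
  refine Finset.sum_congr rfl fun j _ => ?_
  rw [Matrix.mulVec_diagonal]
  have : (Qᴴ *ᵥ (fun k => (f₂ k : ℂ))) j = conj (((fun k => (f₂ k : ℂ)) ᵥ* Q) j) := by
    simp [Matrix.mulVec, Matrix.vecMul, dotProduct, mul_comm]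
  rw [this]
  ring
end

/-- For a real symmetric positive semidefinite matrix `C`, a real
skew-symmetric matrix `B`, `f₁, f₂ ∈ ℝ^n`, and `ψ = w₁ + i w₂` with `w₁, w₂` independent
standard Gaussian vectors in `ℝ^n`, writing `ψ(f) = Σ_k f_k ψ_k`,
`E[ψ(f₁) conj(ψ(f₂)) exp(-(1/2)⟨(C - B)ψ, ψ̄⟩)] = 2 det(I + C + B)⁻¹ ⟨(I + C + B)⁻¹ f₁, f₂⟩`;
equivalently the ratio to `E[exp(-(1/2)⟨(C - B)ψ, ψ̄⟩)]` equals `2⟨(I + C + B)⁻¹ f₁, f₂⟩`. -/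
theorem stmt12 {n : ℕ} (C B : Matrix (Fin n) (Fin n) ℝ)
    (hC : C.PosSemidef) (hB : Bᵀ = -B)
    (f₁ f₂ : Fin n → ℝ) :
    (∫ w : (Fin n → ℝ) × (Fin n → ℝ),
        (∑ k, (f₁ k : ℂ) * ((w.1 k : ℂ) + Complex.I * (w.2 k : ℂ))) *
          conj (∑ k, (f₂ k : ℂ) * ((w.1 k : ℂ) + Complex.I * (w.2 k : ℂ))) *
          Complex.exp (-(1/2) * ∑ k,
            ((C - B).map Complex.ofReal *ᵥ
                (fun j => (w.1 j : ℂ) + Complex.I * (w.2 j : ℂ))) k *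
              conj ((w.1 k : ℂ) + Complex.I * (w.2 k : ℂ)))
        ∂((Measure.pi fun _ : Fin n => gaussianReal 0 1).prod
            (Measure.pi fun _ : Fin n => gaussianReal 0 1))) =
      2 * ((((1 + C + B).det : ℝ) : ℂ))⁻¹ * ((((1 + C + B)⁻¹ *ᵥ f₁) ⬝ᵥ f₂ : ℝ) : ℂ) ∧
    (∫ w : (Fin n → ℝ) × (Fin n → ℝ),
        (∑ k, (f₁ k : ℂ) * ((w.1 k : ℂ) + Complex.I * (w.2 k : ℂ))) *
          conj (∑ k, (f₂ k : ℂ) * ((w.1 k : ℂ) + Complex.I * (w.2 k : ℂ))) *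
          Complex.exp (-(1/2) * ∑ k,
            ((C - B).map Complex.ofReal *ᵥ
                (fun j => (w.1 j : ℂ) + Complex.I * (w.2 j : ℂ))) k *
              conj ((w.1 k : ℂ) + Complex.I * (w.2 k : ℂ)))
        ∂((Measure.pi fun _ : Fin n => gaussianReal 0 1).prod
            (Measure.pi fun _ : Fin n => gaussianReal 0 1))) /
      (∫ w : (Fin n → ℝ) × (Fin n → ℝ),
        Complex.exp (-(1/2) * ∑ k,
          ((C - B).map Complex.ofReal *ᵥ
              (fun j => (w.1 j : ℂ) + Complex.I * (w.2 j : ℂ))) k *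
            conj ((w.1 k : ℂ) + Complex.I * (w.2 k : ℂ)))
        ∂((Measure.pi fun _ : Fin n => gaussianReal 0 1).prod
            (Measure.pi fun _ : Fin n => gaussianReal 0 1))) =
      2 * ((((1 + C + B)⁻¹ *ᵥ f₁) ⬝ᵥ f₂ : ℝ) : ℂ) := by
  obtain ⟨Q, b, hQ, hb, h⟩ := diagonalize C B hC hB
  have hT : (1 + C + B)ᵀ = 1 + C - B := by
    have hCt : Cᵀ = C := hC.1
    rw [Matrix.transpose_add, Matrix.transpose_add, Matrix.transpose_one, hB, hCt, sub_eq_add_neg]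
  obtain ⟨hdet, hZ⟩ := main_Z C B Q b hb h hT
  have hL := main_lin C B Q b hb h hT (Complex.ofReal_ne_zero.mp hdet) f₁ f₂
  have e0 : (∫ w : (Fin n → ℝ) × (Fin n → ℝ),
        Complex.exp (-(1/2) * ∑ k,
          ((C - B).map Complex.ofReal *ᵥ
              (fun j => (w.1 j : ℂ) + Complex.I * (w.2 j : ℂ))) k *
            conj ((w.1 k : ℂ) + Complex.I * (w.2 k : ℂ)))
        ∂((Measure.pi fun _ : Fin n => gaussianReal 0 1).prod
            (Measure.pi fun _ : Fin n => gaussianReal 0 1))) = (((1 + C + B).det : ℝ) : ℂ)⁻¹ := by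
    rw [transfer]
    simp only [re_add]
    simp only [integrand_eq]
    rw [cov Q hQ]
    simp only [quad_eq _ Q b h]
    rw [diag_I0 b hb, hZ]
  have e2 : (∫ w : (Fin n → ℝ) × (Fin n → ℝ),
        (∑ k, (f₁ k : ℂ) * ((w.1 k : ℂ) + Complex.I * (w.2 k : ℂ))) *
          conj (∑ k, (f₂ k : ℂ) * ((w.1 k : ℂ) + Complex.I * (w.2 k : ℂ))) *
          Complex.exp (-(1/2) * ∑ k,
            ((C - B).map Complex.ofReal *ᵥ
                (fun j => (w.1 j : ℂ) + Complex.I * (w.2 j : ℂ))) k *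
              conj ((w.1 k : ℂ) + Complex.I * (w.2 k : ℂ)))
        ∂((Measure.pi fun _ : Fin n => gaussianReal 0 1).prod
            (Measure.pi fun _ : Fin n => gaussianReal 0 1))) =
      2 * ((((1 + C + B).det : ℝ) : ℂ))⁻¹ * ((((1 + C + B)⁻¹ *ᵥ f₁) ⬝ᵥ f₂ : ℝ) : ℂ) := by
    rw [transfer]
    simp only [re_add]
    simp only [mul_assoc _ _ (Complex.exp (-(1/2) * ∑ l, (_ : ℂ))), integrand_eq]
    rw [cov Q hQ]
    simp only [quad_eq _ Q b h]
    have e : ∀ φ : Fin n → ℂ, (∑ k, (f₁ k : ℂ) * (Q *ᵥ φ) k) *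
        (conj (∑ k, (f₂ k : ℂ) * (Q *ᵥ φ) k) *
          Complex.exp (-(1/2) * ∑ l, b l * (φ l * conj (φ l))))
        = (∑ j, ((fun k => (f₁ k : ℂ)) ᵥ* Q) j * φ j) *
          (∑ k, conj (((fun k => (f₂ k : ℂ)) ᵥ* Q) k) * conj (φ k)) *
          Complex.exp (-(1/2) * ∑ l, b l * (φ l * conj (φ l))) := by
      intro φ
      rw [lin_eq Q (fun k => (f₁ k : ℂ)) φ, lin_eq Q (fun k => (f₂ k : ℂ)) φ, map_sum]
      simp only [map_mul]
      ring
    simp only [e]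
    rw [diag_I2 b hb, hL, ← hZ]
    ring
  refine ⟨e2, ?_⟩
  rw [e2, e0]
  field_simp
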